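/- Let E be a real inner product space, p, q ∈ E, v ∈ E with ‖v‖ = 1, and let γ(t) = p + t·v. Fix r > 0, c ≥ 1 and define φ_{r,c}(x) = (x − r) − c·(x − r)²/r. Let f(t) = ‖γ(t) − q‖ and, at a parameter t₀ with f(t₀) > 0, set cos α = ⟪v, q − γ(t₀)⟫/f(t₀). If |f(t₀) − r| ≤ r/(10c), then the function t ↦ φ_{r,c}(f(t)) is twice differentiable at t₀ and its second derivative at t₀ is at most (3 − c·cos²α)/r. -/

import Mathlib

open scoped RealInnerProductSpace

/-- The key second-derivative computation in the proof of Theorem 6.1 (local existence of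
strictly concave functions): along a line `γ(t) = p + t·v`, the function
`t ↦ φ_{r,c}(‖γ(t) - q‖)` with `φ_{r,c}(x) = (x - r) - c(x - r)²/r` has second derivative
at most `(3 - c·cos²α)/r` whenever `‖γ(t₀) - q‖` is within `r/(10c)` of `r`. -/
theorem phi_dist_second_deriv_le
    {E : Type*} [NormedAddCommGroup E] [InnerProductSpace ℝ E]
    (p q v : E) (hv : ‖v‖ = 1) (r c : ℝ) (hr : 0 < r) (hc : 1 ≤ c)
    (t₀ : ℝ)
    (hpos : 0 < ‖(p + t₀ • v) - q‖)
    (hclose : |‖(p + t₀ • v) - q‖ - r| ≤ r / (10 * c)) :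
    ∃ D : ℝ,
      HasDerivAt
        (deriv (fun t : ℝ => (‖(p + t • v) - q‖ - r) - c * (‖(p + t • v) - q‖ - r) ^ 2 / r))
        D t₀ ∧
      D ≤ (3 - c * (⟪v, q - (p + t₀ • v)⟫ / ‖(p + t₀ • v) - q‖) ^ 2) / r := by
  set f : ℝ → ℝ := fun t => ‖(p + t • v) - q‖ with hf
  set g : ℝ → ℝ := fun t => ⟪(p + t • v) - q, v⟫ with hg
  have hγ : ∀ t, HasDerivAt (fun t : ℝ => (p + t • v) - q) v t := by
    intro t
    have h := (((hasDerivAt_id t).smul_const v).const_add p).sub_const q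
    simpa using h
  have hgd : ∀ t, HasDerivAt g 1 t := by
    intro t
    have h := (hγ t).inner ℝ (hasDerivAt_const t v)
    simpa [hg, real_inner_self_eq_norm_sq, hv] using h
  have hfd : ∀ t, 0 < f t → HasDerivAt f (g t / f t) t := by
    intro t ht
    have h := ((hγ t).norm_sq).sqrt (by have := pow_pos ht 2; exact this.ne')
    have e : (fun t : ℝ => √(‖(p + t • v) - q‖ ^ 2)) = f := by
      funext s
      exact Real.sqrt_sq (norm_nonneg _)
    rw [e, Real.sqrt_sq (norm_nonneg _)] at h
    convert h using 1
    change g t / f t = 2 * g t / (2 * f t)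
    field_simp
  have hfc : Continuous f := by
    simp only [hf]
    fun_prop
  have hpos' : 0 < f t₀ := hpos
  have hev : ∀ᶠ t in nhds t₀, 0 < f t := hfc.continuousAt.eventually (lt_mem_nhds hpos')
  have hd1 : ∀ t, 0 < f t → HasDerivAt (fun t => (f t - r) - c * (f t - r) ^ 2 / r)
      ((1 - 2 * c * (f t - r) / r) * (g t / f t)) t := by
    intro t ht
    have h1 := (hfd t ht).sub_const r
    have h := h1.sub (((h1.pow 2).const_mul c).div_const r)
    refine h.congr_deriv ?_
    push_cast
    ring
  have heq : deriv (fun t => (f t - r) - c * (f t - r) ^ 2 / r) =ᶠ[nhds t₀]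
      fun t => (1 - 2 * c * (f t - r) / r) * (g t / f t) :=
    hev.mono fun t ht => (hd1 t ht).deriv
  have h1 := hfd t₀ hpos'
  have h2 := ((((h1.sub_const r).const_mul (2 * c)).div_const r).const_sub 1).mul
    ((hgd t₀).div h1 hpos'.ne')
  refine ⟨_, h2.congr_of_eventuallyEq heq, ?_⟩
  have hin : ⟪v, q - (p + t₀ • v)⟫ = - g t₀ := by
    rw [← neg_sub, inner_neg_right, real_inner_comm]
  have hCS : (g t₀ / f t₀) ^ 2 ≤ 1 := by
    have h := abs_real_inner_le_norm ((p + t₀ • v) - q) v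
    rw [hv, mul_one] at h
    rw [sq_le_one_iff_abs_le_one, abs_div, abs_of_pos hpos', div_le_one hpos']
    exact h
  rw [hin, Pi.div_apply]
  change |f t₀ - r| ≤ _ at hclose
  change _ ≤ (3 - c * (- g t₀ / f t₀) ^ 2) / r
  generalize f t₀ = F at *
  generalize g t₀ = G at *
  obtain ⟨u, hu⟩ : ∃ u, u = G / F := ⟨_, rfl⟩
  have hG : G = u * F := by rw [hu]; field_simp
  clear hu
  subst hG
  have hc0 : 0 < c := by linarith
  rw [mul_div_assoc, div_self hpos'.ne', mul_one] at hCS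
  rw [neg_div, neg_sq, mul_div_cancel_right₀ u hpos'.ne']
  have hcd : |c * (F - r)| ≤ r / 10 := by
    rw [abs_mul, abs_of_pos hc0]
    calc c * |F - r| ≤ c * (r / (10 * c)) := by gcongr
      _ = r / 10 := by field_simp
  have hF : 9 / 10 * r ≤ F := by
    have : r / (10 * c) ≤ r / 10 := by gcongr; linarith
    have := (abs_le.mp hclose).1
    linarith
  have hA : 1 - 2 * c * (F - r) / r ≤ 6 / 5 := by
    have := (abs_le.mp hcd).1
    rw [sub_le_comm, le_div_iff₀ hr]
    linarith
  have hkey : (1 - 2 * c * (F - r) / r) * ((1 - u ^ 2) / F) ≤ 6 / 5 * (1 / (9 / 10 * r)) := by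
    have h0 : 0 ≤ (1 - u ^ 2) / F := div_nonneg (by linarith) hpos'.le
    have h3 : (1 - u ^ 2) / F ≤ 1 / (9 / 10 * r) :=
      div_le_div₀ (by norm_num) (by nlinarith [sq_nonneg u]) (by positivity) hF
    calc _ ≤ 6 / 5 * ((1 - u ^ 2) / F) := by gcongr
      _ ≤ _ := by gcongr
  calc _ = (1 - 2 * c * (F - r) / r) * ((1 - u ^ 2) / F) - 2 * c * u ^ 2 / r := by
        field_simp
        ring
    _ ≤ 6 / 5 * (1 / (9 / 10 * r)) - 2 * c * u ^ 2 / r := by gcongr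
    _ = (4 / 3 - 2 * c * u ^ 2) / r := by field_simp; ring
    _ ≤ _ := by
        gcongr ?_ / r
        nlinarith [mul_nonneg hc0.le (sq_nonneg u)]
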